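/- arXiv:1606.07288 — 2 statements merged into one kernel-verified Lean document; each statement's English description precedes it below -/
import Mathlib

section
/- The dual split Cayley hexagon H(2)^D has no distance-2 ovoid; equivalently, there is no set O of points of H(2)^D such that every line of H(2)^D is incident with exactly one element of O. -/
open SimpleGraph
section DualSplitCayley

variable (F : Type*) [Field F]

/-- The quadratic form `Q(x) = x₀x₄ + x₁x₅ + x₂x₆ − x₃²` on `F^7`. -/
def hexQF (x : Fin 7 → F) : F := x 0 * x 4 + x 1 * x 5 + x 2 * x 6 - x 3 ^ 2

/-- Grassmann coordinate `p_{ij} = x_i y_j − x_j y_i`. -/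
def grassCoord (x y : Fin 7 → F) (i j : Fin 7) : F := x i * y j - x j * y i

/-- Lines of the dual split Cayley hexagon `H(q)^D`: 1-dimensional subspaces of `F^7`
on which `Q` vanishes. -/
def IsHexLine (U : Submodule F (Fin 7 → F)) : Prop :=
  Module.finrank F U = 1 ∧ ∀ x ∈ U, hexQF F x = 0

/-- Points of the dual split Cayley hexagon `H(q)^D`: 2-dimensional subspaces of `F^7`
on which `Q` vanishes and whose Grassmann coordinates satisfy the six linear conditions. -/
def IsHexPoint (W : Submodule F (Fin 7 → F)) : Prop :=
  Module.finrank F W = 2 ∧ (∀ x ∈ W, hexQF F x = 0) ∧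
  ∀ x ∈ W, ∀ y ∈ W,
    grassCoord F x y 1 2 = grassCoord F x y 3 4 ∧
    grassCoord F x y 5 4 = grassCoord F x y 3 2 ∧
    grassCoord F x y 2 0 = grassCoord F x y 3 5 ∧
    grassCoord F x y 6 5 = grassCoord F x y 3 0 ∧
    grassCoord F x y 0 1 = grassCoord F x y 3 6 ∧
    grassCoord F x y 4 6 = grassCoord F x y 3 1

end DualSplitCayley

/-- The vector of `F_2^7` whose coordinates are the binary digits of `n`. -/
def hexVec (n : ℕ) : Fin 7 → ZMod 2 := fun i => if n.testBit i then 1 else 0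

/-- Two vectors that may lie in a common point of `H(2)^D`. -/
def HexColl (x y : Fin 7 → ZMod 2) : Prop :=
  hexQF (ZMod 2) y = 0 ∧ hexQF (ZMod 2) (x + y) = 0 ∧
    grassCoord (ZMod 2) x y 1 2 = grassCoord (ZMod 2) x y 3 4 ∧
    grassCoord (ZMod 2) x y 5 4 = grassCoord (ZMod 2) x y 3 2 ∧
    grassCoord (ZMod 2) x y 2 0 = grassCoord (ZMod 2) x y 3 5 ∧
    grassCoord (ZMod 2) x y 6 5 = grassCoord (ZMod 2) x y 3 0 ∧
    grassCoord (ZMod 2) x y 0 1 = grassCoord (ZMod 2) x y 3 6 ∧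
    grassCoord (ZMod 2) x y 4 6 = grassCoord (ZMod 2) x y 3 1

instance (x y : Fin 7 → ZMod 2) : Decidable (HexColl x y) := by
  unfold HexColl; infer_instance

/-- The point sets (triples of codes of singular vectors) of the 63 totally singular subspaces. -/
def hexBlocks : List (List ℕ) :=
  [[1, 32, 33], [1, 64, 65], [1, 96, 97], [2, 16, 18], [2, 64, 66],
   [2, 80, 82], [3, 48, 51], [3, 64, 67], [3, 112, 115], [4, 16, 20],
   [4, 32, 36], [4, 48, 52], [5, 32, 37], [5, 80, 85], [5, 112, 117],
   [6, 16, 22], [6, 96, 102], [6, 112, 118], [7, 48, 55], [7, 80, 87],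
   [7, 96, 103], [18, 76, 94], [18, 78, 92], [20, 42, 62], [20, 46, 58],
   [22, 106, 124], [22, 108, 122], [25, 36, 61], [25, 66, 91], [25, 102, 127],
   [27, 47, 52], [27, 66, 89], [27, 109, 118], [29, 36, 57], [29, 79, 82],
   [29, 107, 118], [31, 43, 52], [31, 77, 82], [31, 102, 121], [33, 76, 109],
   [33, 77, 108], [37, 89, 124], [37, 92, 121], [42, 65, 107], [42, 85, 127],
   [43, 65, 106], [43, 94, 117], [46, 79, 97], [46, 91, 117], [47, 78, 97],
   [47, 85, 122], [51, 76, 127], [51, 79, 124], [55, 91, 108], [55, 92, 107],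
   [57, 67, 122], [57, 94, 103], [58, 67, 121], [58, 87, 109], [61, 78, 115],
   [61, 87, 106], [62, 77, 115], [62, 89, 103]]

/-- The order in which the lines are branched on. -/
def hexOrder : List ℕ :=
  [82, 2, 18, 64, 79, 51, 76, 3, 77, 115, 78, 33, 97, 1, 65, 43,
   31, 94, 103, 96, 62, 102, 127, 42, 57, 29, 67, 92, 107, 121, 122, 85,
   108, 91, 117, 112, 27, 25, 6]

/-- Whether two triples have no common element. -/
def hexDisj (s t : List ℕ) : Bool := s.all fun a => t.all fun b => !(Nat.beq a b)

/-- Whether two triples are equal or have no common element. -/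
def hexCompat (s t : List ℕ) : Bool := s == t || hexDisj s t

/-- Exhaustive search for an exact cover; `true` means that there is none. -/
def hexRefute : List ℕ → List (List ℕ) → Bool
  | [], _ => false
  | v :: vs, avail =>
    (avail.filter fun t => t.any fun a => Nat.beq a v).all fun t =>
      hexRefute vs (avail.filter (hexCompat t))

theorem hexRefute_sound (sel : List ℕ → Prop)
    (hu : ∀ s ∈ hexBlocks, ∀ t ∈ hexBlocks, sel s → sel t → hexCompat s t = true) :
    ∀ (vs : List ℕ) (avail : List (List ℕ)),
      (∀ v ∈ vs, ∃ t ∈ hexBlocks, sel t ∧ v ∈ t) →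
      (∀ t ∈ hexBlocks, sel t → t ∈ avail) → hexRefute vs avail = false := by
  intro vs
  induction vs with
  | nil => intro avail _ _; rfl
  | cons v vs ih =>
    intro avail hv ha
    obtain ⟨t, ht, hst, hvt⟩ := hv v (by simp)
    have h := ih (avail.filter (hexCompat t)) (fun w hw => hv w (by simp [hw]))
      (fun s hs hss => List.mem_filter.2 ⟨ha s hs hss, hu t ht s hs hst hss⟩)
    rw [hexRefute, List.all_eq_false]
    refine ⟨t, List.mem_filter.2 ⟨ha t ht hst, ?_⟩, by simp [h]⟩
    rw [List.any_eq_true]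
    exact ⟨v, hvt, by simp⟩

theorem hexRefute_eq : hexRefute hexOrder hexBlocks = true := by decide +kernel

theorem hexVec_surj : ∀ w : Fin 7 → ZMod 2, ∃ m < 128, hexVec m = w := by
  decide +kernel

theorem hexVec_xor (a b : ℕ) : hexVec (a ^^^ b) = hexVec a + hexVec b := by
  funext i
  simp only [hexVec, Nat.testBit_xor, Pi.add_apply]
  cases a.testBit i <;> cases b.testBit i <;> decide

theorem hexOrder_sing : ∀ v ∈ hexOrder, hexVec v ≠ 0 ∧ hexQF (ZMod 2) (hexVec v) = 0 := by
  decide +kernel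

theorem hexBlocks_sing : ∀ t ∈ hexBlocks, ∀ v ∈ t,
    hexVec v ≠ 0 ∧ hexQF (ZMod 2) (hexVec v) = 0 := by
  decide +kernel

theorem hexBlocks_complete : ∀ v ∈ hexOrder, ∀ m < 128, m ≠ 0 → m ≠ v →
    HexColl (hexVec v) (hexVec m) →
    ∃ t ∈ hexBlocks, v ∈ t ∧ ∀ a ∈ t, a = v ∨ a = m ∨ a = v ^^^ m := by
  decide +kernel

theorem hexBlocks_unique : ∀ s ∈ hexBlocks, ∀ t ∈ hexBlocks, hexCompat s t = false →
    ∃ x ∈ s, ∃ y ∈ t, ¬ HexColl (hexVec x) (hexVec y) := by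
  decide +kernel

theorem hexCompat_of (s t : List ℕ) (h : ∀ a ∈ s, a ∉ t) : hexCompat s t = true := by
  simp only [hexCompat, hexDisj, Bool.or_eq_true, List.all_eq_true]
  right
  intro a ha b hb
  have : a ≠ b := fun e => h a ha (e ▸ hb)
  rw [Bool.not_eq_true', ← Bool.not_eq_true, Nat.beq_eq]
  exact this

theorem hexPoint_coll {W : Submodule (ZMod 2) (Fin 7 → ZMod 2)} (hW : IsHexPoint (ZMod 2) W)
    {x y : Fin 7 → ZMod 2} (hx : x ∈ W) (hy : y ∈ W) : HexColl x y :=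
  ⟨hW.2.1 y hy, hW.2.1 _ (W.add_mem hx hy), hW.2.2 x hx y hy⟩

theorem hexLine_span {x : Fin 7 → ZMod 2} (h0 : x ≠ 0) (hQ : hexQF (ZMod 2) x = 0) :
    IsHexLine (ZMod 2) (Submodule.span (ZMod 2) {x}) := by
  refine ⟨finrank_span_singleton h0, ?_⟩
  intro y hy
  obtain ⟨c, rfl⟩ := Submodule.mem_span_singleton.1 hy
  have hc : hexQF (ZMod 2) (c • x) = c ^ 2 * hexQF (ZMod 2) x := by
    simp only [hexQF, Pi.smul_apply, smul_eq_mul]; ring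
  rw [hc, hQ, mul_zero]

theorem hexPoint_exists {W : Submodule (ZMod 2) (Fin 7 → ZMod 2)} (hW : IsHexPoint (ZMod 2) W)
    (x : Fin 7 → ZMod 2) : ∃ w ∈ W, w ≠ 0 ∧ w ≠ x := by
  by_contra! h
  have hle : W ≤ Submodule.span (ZMod 2) {x} := by
    intro w hw
    by_cases h0 : w = 0
    · rw [h0]; exact Submodule.zero_mem _
    · rw [h w hw h0]; exact Submodule.mem_span_singleton_self x
  have h1 := Submodule.finrank_mono hle
  have h2 := finrank_span_le_card (R := ZMod 2) ({x} : Set (Fin 7 → ZMod 2))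
  have h3 := hW.1
  simp at h2
  omega

/-- The dual split Cayley hexagon `H(2)^D` has no distance-2 ovoid: there is no set `O`
of points such that every line is incident with exactly one element of `O`. -/
theorem H2D_has_no_distance_two_ovoid :
    ¬ ∃ O : Set {W : Submodule (ZMod 2) (Fin 7 → ZMod 2) // IsHexPoint (ZMod 2) W},
      ∀ l : {U : Submodule (ZMod 2) (Fin 7 → ZMod 2) // IsHexLine (ZMod 2) U},
        ∃! p : {W : Submodule (ZMod 2) (Fin 7 → ZMod 2) // IsHexPoint (ZMod 2) W},
          p ∈ O ∧ (l : Submodule (ZMod 2) (Fin 7 → ZMod 2)) ≤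
            (p : Submodule (ZMod 2) (Fin 7 → ZMod 2)) := by
  rintro ⟨O, hO⟩
  have key : ∀ x : Fin 7 → ZMod 2, x ≠ 0 → hexQF (ZMod 2) x = 0 →
      ∃! p : {W : Submodule (ZMod 2) (Fin 7 → ZMod 2) // IsHexPoint (ZMod 2) W},
        p ∈ O ∧ x ∈ p.1 := by
    intro x h0 hQ
    have h := hO ⟨_, hexLine_span h0 hQ⟩
    simpa only [Submodule.span_singleton_le_iff_mem] using h
  have hfalse := hexRefute_sound (fun t => ∃ p ∈ O, ∀ a ∈ t, hexVec a ∈ p.1) ?_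
    hexOrder hexBlocks ?_ (fun t ht _ => ht)
  · rw [hexRefute_eq] at hfalse
    exact absurd hfalse (by decide)
  · rintro s hs t ht ⟨p, hp, hps⟩ ⟨p', hp', hpt⟩
    by_contra hc
    have hc' : hexCompat s t = false := by simpa using hc
    have hsh : ∃ a ∈ s, a ∈ t := by
      by_contra! hn
      exact hc (hexCompat_of s t hn)
    obtain ⟨a, has, hat⟩ := hsh
    obtain ⟨h0, hQ⟩ := hexBlocks_sing s hs a has
    have hpp : p = p' := (key _ h0 hQ).unique ⟨hp, hps a has⟩ ⟨hp', hpt a hat⟩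
    subst hpp
    obtain ⟨x, hx, y, hy, hxy⟩ := hexBlocks_unique s hs t ht hc'
    exact hxy (hexPoint_coll p.2 (hps x hx) (hpt y hy))
  · intro v hv
    obtain ⟨h0, hQ⟩ := hexOrder_sing v hv
    obtain ⟨p, ⟨hp, hvp⟩, _⟩ := key _ h0 hQ
    obtain ⟨w, hw, hw0, hwv⟩ := hexPoint_exists p.2 (hexVec v)
    obtain ⟨m, hm, rfl⟩ := hexVec_surj w
    have hm0 : m ≠ 0 := by
      rintro rfl
      exact hw0 (by funext i; simp [hexVec])
    have hmv : m ≠ v := by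
      rintro rfl
      exact hwv rfl
    obtain ⟨t, ht, hvt, hta⟩ := hexBlocks_complete v hv m hm hm0 hmv (hexPoint_coll p.2 hvp hw)
    refine ⟨t, ht, ⟨p, hp, ?_⟩, hvt⟩
    intro a ha
    rcases hta a ha with rfl | rfl | rfl
    · exact hvp
    · exact hw
    · rw [hexVec_xor]
      exact Submodule.add_mem _ hvp hw
end

section
/- Every partial distance-2 ovoid of the dual split Cayley hexagon H(2)^D has at most 19 elements; that is, any set O of points of H(2)^D such that no line of H(2)^D is incident with two distinct elements of O satisfies |O| ≤ 19. -/
open SimpleGraph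
namespace H2D

/-- The 63 points of `H(2)^D`, each as the triple of its nonzero vectors (binary codes). -/
def tbl : List (ℕ × ℕ × ℕ) :=
  [
   (1, 32, 33), (1, 64, 65), (1, 96, 97), (2, 16, 18), (2, 64, 66), (2, 80, 82), (3, 48, 51),
   (3, 64, 67), (3, 112, 115), (4, 16, 20), (4, 32, 36), (4, 48, 52), (5, 32, 37), (5, 80, 85),
   (5, 112, 117), (6, 16, 22), (6, 96, 102), (6, 112, 118), (7, 48, 55), (7, 80, 87), (7, 96,
   103), (18, 76, 94), (18, 78, 92), (20, 42, 62), (20, 46, 58), (22, 106, 124), (22, 108,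
   122), (25, 36, 61), (25, 66, 91), (25, 102, 127), (27, 47, 52), (27, 66, 89), (27, 109,
   118), (29, 36, 57), (29, 79, 82), (29, 107, 118), (31, 43, 52), (31, 77, 82), (31, 102,
   121), (33, 76, 109), (33, 77, 108), (37, 89, 124), (37, 92, 121), (42, 65, 107), (42, 85,
   127), (43, 65, 106), (43, 94, 117), (46, 79, 97), (46, 91, 117), (47, 78, 97), (47, 85,
   122), (51, 76, 127), (51, 79, 124), (55, 91, 108), (55, 92, 107), (57, 67, 122), (57, 94,
   103), (58, 67, 121), (58, 87, 109), (61, 78, 115), (61, 87, 106), (62, 77, 115), (62, 89,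
   103)]

/-- Universal embedding of the 63 singular vectors in `F_2^14` (binary codes). -/
def embT : List ℕ :=
  [
   0, 1, 2, 4, 8, 16, 32, 64, 0, 0, 0, 0, 0, 0, 0, 0, 128, 0, 130, 0, 136, 0, 160, 0, 0, 256,
   0, 512, 0, 1024, 0, 1877, 2048, 2049, 0, 0, 2056, 2064, 0, 0, 0, 0, 4096, 2739, 0, 0, 5427,
   4070, 3566, 0, 0, 3562, 3558, 0, 0, 3502, 0, 3080, 5563, 0, 0, 2312, 4232, 0, 8192, 8193,
   8194, 8196, 0, 0, 0, 0, 0, 0, 0, 0, 15872, 9389, 15661, 10232, 9210, 0, 9208, 0, 0, 9194, 0,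
   9146, 0, 8706, 0, 8450, 15791, 0, 16002, 0, 13002, 13003, 0, 0, 0, 0, 13034, 12938, 0, 0,
   10930, 12289, 11436, 13825, 0, 0, 13345, 0, 0, 13349, 0, 13361, 13313, 0, 0, 13759, 11276,
   0, 10770, 0, 0, 13290]

/-- The singular vectors in a convenient search order. -/
def ord : List ℕ :=
  [
   1, 33, 32, 109, 76, 58, 87, 61, 36, 106, 25, 127, 65, 64, 66, 67, 121, 102, 42, 3, 51, 124,
   37, 89, 27, 48, 4, 20, 62, 115, 77, 52, 31, 43, 47, 85, 78, 122, 22, 108, 5, 16, 112, 6,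
   118, 18, 92, 2, 80, 82, 107, 29, 55, 7, 79, 97, 96, 103, 57, 94, 91, 117, 46]

def emb (v : ℕ) : ℕ := embT.getD v 0

def pts (t : ℕ × ℕ × ℕ) : Finset ℕ := {t.1, t.2.1, t.2.2}

def hasPt (t : ℕ × ℕ × ℕ) (v : ℕ) : Bool :=
  Nat.beq t.1 v || (Nat.beq t.2.1 v || Nat.beq t.2.2 v)

lemma hasPt_iff (t : ℕ × ℕ × ℕ) (v : ℕ) : hasPt t v = true ↔ v ∈ pts t := by
  simp [hasPt, pts, Nat.beq_eq, @eq_comm ℕ v]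

def clash (cov : ℕ) (t : ℕ × ℕ × ℕ) : Bool :=
  cov.testBit t.1 || (cov.testBit t.2.1 || cov.testBit t.2.2)

lemma clash_iff (cov : ℕ) (t : ℕ × ℕ × ℕ) :
    clash cov t = true ↔ ∃ v ∈ pts t, cov.testBit v = true := by
  simp [clash, pts]

def ins3 (cov : ℕ) (t : ℕ × ℕ × ℕ) : ℕ :=
  cov ||| (2 ^ t.1 ||| (2 ^ t.2.1 ||| 2 ^ t.2.2))

lemma ins3_iff (cov : ℕ) (t : ℕ × ℕ × ℕ) (v : ℕ) :
    (ins3 cov t).testBit v = true ↔ cov.testBit v = true ∨ v ∈ pts t := by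
  simp [ins3, pts, Nat.testBit_or, Nat.testBit_two_pow, @eq_comm ℕ v]

/-- Refutation search for exact covers. -/
def srch : List ℕ → ℕ → Bool
  | [], _ => false
  | v :: vs, cov => cond (cov.testBit v) (srch vs cov)
      (tbl.all fun t => !(hasPt t v) || (clash cov t || srch vs (ins3 cov t)))

lemma srch_sound (S : Finset (ℕ × ℕ × ℕ)) (hS : ∀ t ∈ S, t ∈ tbl)
    (hd : ∀ t ∈ S, ∀ s ∈ S, ∀ v, v ∈ pts t → v ∈ pts s → t = s) (vs : List ℕ)
    (hc : ∀ v ∈ vs, ∃ t ∈ S, v ∈ pts t) (cov : ℕ)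
    (hcov : ∀ w, cov.testBit w = true → ∃ t ∈ S, w ∈ pts t ∧ ∀ u ∈ pts t, cov.testBit u = true) :
    srch vs cov = false := by
  induction vs generalizing cov with
  | nil => rfl
  | cons v vs ih =>
    have ih' := ih (fun w hw => hc w (List.mem_cons_of_mem _ hw))
    rw [srch]
    cases hv : cov.testBit v with
    | true => exact ih' cov hcov
    | false =>
      obtain ⟨t, ht, hvt⟩ := hc v List.mem_cons_self
      rw [cond_false, List.all_eq_false]
      refine ⟨t, hS t ht, ?_⟩
      have h1 : hasPt t v = true := (hasPt_iff t v).2 hvt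
      have h2 : clash cov t = false := by
        by_contra h
        rw [Bool.not_eq_false, clash_iff] at h
        obtain ⟨w, hwt, hw⟩ := h
        obtain ⟨s, hs, hws, hall⟩ := hcov w hw
        obtain rfl := hd t ht s hs w hwt hws
        rw [hall v hvt] at hv
        exact absurd hv (by decide)
      have h3 : srch vs (ins3 cov t) = false := by
        apply ih'
        intro w hw
        rcases (ins3_iff _ _ _).1 hw with hw | hw
        · obtain ⟨s, hs, hws, hall⟩ := hcov w hw
          exact ⟨s, hs, hws, fun u hu => (ins3_iff _ _ _).2 (Or.inl (hall u hu))⟩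
        · exact ⟨t, ht, hw, fun u hu => (ins3_iff _ _ _).2 (Or.inr hu)⟩
      simp [h1, h2, h3]

set_option maxRecDepth 100000 in
lemma srch_true : srch ord 0 = true := by decide +kernel

/-- No exact cover, i.e. no distance-2 ovoid. -/
lemma no_ovoid (S : Finset (ℕ × ℕ × ℕ)) (hS : ∀ t ∈ S, t ∈ tbl)
    (hd : ∀ t ∈ S, ∀ s ∈ S, ∀ v, v ∈ pts t → v ∈ pts s → t = s)
    (hc : ∀ v ∈ ord, ∃ t ∈ S, v ∈ pts t) : False := by
  have := srch_sound S hS hd ord hc 0 (by simp)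
  rw [srch_true] at this
  exact absurd this (by decide)

/-- The `k`-th bit of `n`, in `F_2`. -/
def gb (n k : ℕ) : ZMod 2 := if n.testBit k then 1 else 0

lemma gb_xor (m n k : ℕ) : gb (m ^^^ n) k = gb m k + gb n k := by
  simp only [gb, Nat.testBit_xor]
  cases m.testBit k <;> cases n.testBit k <;> decide

lemma gb_inj {m n : ℕ} (h : ∀ k, gb m k = gb n k) : m = n := by
  apply Nat.eq_of_testBit_eq
  intro k
  have := h k
  simp only [gb] at this
  revert this
  cases m.testBit k <;> cases n.testBit k <;> decide

def V : Finset ℕ := ord.toFinset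

lemma tbl_ok : ∀ t ∈ tbl, t.1 < t.2.1 ∧ t.2.1 < t.2.2 ∧ t.1 ∈ ord ∧ t.2.1 ∈ ord ∧ t.2.2 ∈ ord ∧
    t.1 ^^^ t.2.1 = t.2.2 ∧ emb t.1 ^^^ emb t.2.1 = emb t.2.2 := by decide +kernel

lemma V_card : V.card = 63 := by decide +kernel

lemma sum_id : ord.foldr (fun v a => v ^^^ a) 0 = 0 := by decide +kernel
lemma sum_emb : ord.foldr (fun v a => emb v ^^^ a) 0 = 0 := by decide +kernel
lemma ord_nodup : ord.Nodup := by decide +kernel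

lemma pair_ok : ∀ a ∈ ord, ∀ b ∈ ord, Nat.beq a b = true ∨
    Nat.beq (emb a ^^^ emb b) (emb (a ^^^ b)) = false ∨
    (tbl.any fun t => hasPt t a && (hasPt t b && hasPt t (a ^^^ b))) = true := by
  decide +kernel

lemma foldr_gb (f : ℕ → ℕ) (l : List ℕ) (k : ℕ) :
    gb (l.foldr (fun v a => f v ^^^ a) 0) k = (l.map fun v => gb (f v) k).sum := by
  induction l with
  | nil => simp [gb]
  | cons v l ih => simp [gb_xor, ih]

lemma sum_V (f : ℕ → ℕ) (hf : ord.foldr (fun v a => f v ^^^ a) 0 = 0) (k : ℕ) :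
    ∑ v ∈ V, gb (f v) k = 0 := by
  rw [V, List.sum_toFinset _ ord_nodup, ← foldr_gb, hf]
  simp [gb]

lemma pts_card {t : ℕ × ℕ × ℕ} (ht : t ∈ tbl) : (pts t).card = 3 := by
  obtain ⟨h1, h2, -⟩ := tbl_ok t ht
  rw [pts, Finset.card_eq_three]
  exact ⟨_, _, _, by omega, by omega, by omega, rfl⟩

lemma pts_V {t : ℕ × ℕ × ℕ} (ht : t ∈ tbl) : pts t ⊆ V := by
  obtain ⟨h1, h2, h3, h4, h5, -⟩ := tbl_ok t ht
  intro v hv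
  simp only [pts, Finset.mem_insert, Finset.mem_singleton] at hv
  rw [V, List.mem_toFinset]
  rcases hv with rfl | rfl | rfl <;> assumption

lemma line_sum (f : ℕ → ℕ) (hl : ∀ t ∈ tbl, f t.1 ^^^ f t.2.1 = f t.2.2)
    {t : ℕ × ℕ × ℕ} (ht : t ∈ tbl) (k : ℕ) : ∑ v ∈ pts t, gb (f v) k = 0 := by
  obtain ⟨h1, h2, -⟩ := tbl_ok t ht
  rw [pts, Finset.sum_insert, Finset.sum_pair, ← hl t ht, gb_xor]
  · generalize gb (f t.1) k = a
    generalize gb (f t.2.1) k = b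
    revert a b
    decide
  · omega
  · simp only [Finset.mem_insert, Finset.mem_singleton]
    omega

lemma holes_sum (S : Finset (ℕ × ℕ × ℕ)) (hS : ∀ t ∈ S, t ∈ tbl)
    (hd : ∀ t ∈ S, ∀ s ∈ S, ∀ v, v ∈ pts t → v ∈ pts s → t = s)
    (f : ℕ → ℕ) (hf : ord.foldr (fun v a => f v ^^^ a) 0 = 0)
    (hl : ∀ t ∈ tbl, f t.1 ^^^ f t.2.1 = f t.2.2) (k : ℕ) :
    ∑ v ∈ V \ S.biUnion pts, gb (f v) k = 0 := by
  have hsub : S.biUnion pts ⊆ V := Finset.biUnion_subset.2 fun t ht => pts_V (hS t ht)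
  have h := Finset.sum_sdiff (f := fun v => gb (f v) k) hsub
  have hz : ∑ v ∈ S.biUnion pts, gb (f v) k = 0 := by
    rw [Finset.sum_biUnion]
    · refine Finset.sum_eq_zero fun t ht => ?_
      exact line_sum f hl (hS t ht) k
    · intro t ht s hs hts
      exact Finset.disjoint_left.2 fun v h1 h2 => hts (hd t ht s hs v h1 h2)
  rw [sum_V f hf k, hz, add_zero] at h
  exact h

lemma comb (S : Finset (ℕ × ℕ × ℕ)) (hS : ∀ t ∈ S, t ∈ tbl)
    (hd : ∀ t ∈ S, ∀ s ∈ S, ∀ v, v ∈ pts t → v ∈ pts s → t = s) : S.card ≤ 19 := by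
  by_contra hcon
  obtain ⟨S', hS', hcard⟩ := Finset.exists_subset_card_eq (show 20 ≤ S.card by omega)
  replace hS : ∀ t ∈ S', t ∈ tbl := fun t ht => hS t (hS' ht)
  replace hd : ∀ t ∈ S', ∀ s ∈ S', ∀ v, v ∈ pts t → v ∈ pts s → t = s :=
    fun t ht s hs => hd t (hS' ht) s (hS' hs)
  clear hS' hcon
  have hsub : S'.biUnion pts ⊆ V := Finset.biUnion_subset.2 fun t ht => pts_V (hS t ht)
  have hU : (S'.biUnion pts).card = 60 := by
    rw [Finset.card_biUnion, Finset.sum_congr rfl fun t ht => pts_card (hS t ht)]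
    · simp [hcard]
    · intro t ht s hs hts
      exact Finset.disjoint_left.2 fun v h1 h2 => hts (hd t ht s hs v h1 h2)
  have hH : (V \ S'.biUnion pts).card = 3 := by
    rw [Finset.card_sdiff_of_subset hsub, V_card, hU]
  have hs1 := holes_sum S' hS hd (fun v => v) sum_id
    (fun t ht => (tbl_ok t ht).2.2.2.2.2.1)
  have hs2 := holes_sum S' hS hd emb sum_emb
    (fun t ht => (tbl_ok t ht).2.2.2.2.2.2)
  obtain ⟨a, b, c, hab, hac, hbc, habc⟩ := Finset.card_eq_three.1 hH
  have key : ∀ f : ℕ → ℕ, (∀ k, ∑ v ∈ V \ S'.biUnion pts, gb (f v) k = 0) →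
      f a ^^^ f b = f c := by
    intro f hf
    apply gb_inj
    intro k
    have := hf k
    rw [habc, Finset.sum_insert (by simp [hab, hac]), Finset.sum_pair hbc] at this
    rw [gb_xor]
    revert this
    generalize gb (f a) k = x
    generalize gb (f b) k = y
    generalize gb (f c) k = z
    revert x y z
    decide
  have k1 := key _ hs1
  have k2 := key _ hs2
  have hmem : ∀ v ∈ ({a, b, c} : Finset ℕ), v ∈ ord := by
    intro v hv
    rw [← habc, Finset.mem_sdiff, V, List.mem_toFinset] at hv
    exact hv.1
  obtain ⟨t, ht, hta⟩ : ∃ t ∈ tbl, a ∈ pts t ∧ b ∈ pts t ∧ c ∈ pts t := by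
    rcases pair_ok a (hmem a (by simp)) b (hmem b (by simp)) with h | h | h
    · exact absurd (Nat.beq_eq ▸ h) hab
    · rw [k1, k2] at h
      simp at h
    · rw [List.any_eq_true] at h
      obtain ⟨t, ht, h⟩ := h
      rw [Bool.and_eq_true, Bool.and_eq_true, k1, hasPt_iff, hasPt_iff, hasPt_iff] at h
      exact ⟨t, ht, h⟩
  have hpt : pts t = V \ S'.biUnion pts := by
    symm
    apply Finset.eq_of_subset_of_card_le
    · rw [habc]
      intro v hv
      simp only [Finset.mem_insert, Finset.mem_singleton] at hv
      rcases hv with rfl | rfl | rfl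
      exacts [hta.1, hta.2.1, hta.2.2]
    · rw [hH, pts_card ht]
  have hdis : ∀ s ∈ S', ∀ v, v ∈ pts t → v ∉ pts s := by
    intro s hs v hv hvs
    rw [hpt, Finset.mem_sdiff] at hv
    exact hv.2 (Finset.mem_biUnion.2 ⟨s, hs, hvs⟩)
  apply no_ovoid (insert t S')
  · intro s hs
    rcases Finset.mem_insert.1 hs with rfl | hs
    exacts [ht, hS s hs]
  · intro s hs r hr v hvs hvr
    rcases Finset.mem_insert.1 hs with h1 | h1 <;> rcases Finset.mem_insert.1 hr with h2 | h2
    · rw [h1, h2]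
    · exact absurd hvr (hdis r h2 v (h1 ▸ hvs))
    · exact absurd hvs (hdis s h1 v (h2 ▸ hvr))
    · exact hd s h1 r h2 v hvs hvr
  · intro v hv
    by_cases h : v ∈ S'.biUnion pts
    · obtain ⟨s, hs, hvs⟩ := Finset.mem_biUnion.1 h
      exact ⟨s, Finset.mem_insert_of_mem hs, hvs⟩
    · refine ⟨t, Finset.mem_insert_self _ _, ?_⟩
      rw [hpt, Finset.mem_sdiff]
      exact ⟨List.mem_toFinset.2 hv, h⟩

/-- Decoding of binary codes. -/
def dec (n : ℕ) : Fin 7 → ZMod 2 := fun i => gb n i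

lemma dec_xor (m n : ℕ) : dec (m ^^^ n) = dec m + dec n := by
  funext i
  exact gb_xor m n i

lemma dec_surj : ∀ x : Fin 7 → ZMod 2, ∃ m ∈ List.range 128, dec m = x := by decide +kernel

lemma dec_ne_zero : ∀ v ∈ ord, dec v ≠ 0 := by decide +kernel

lemma sing_mem : ∀ m ∈ List.range 128, dec m ≠ 0 → hexQF (ZMod 2) (dec m) = 0 → m ∈ ord := by
  decide +kernel

/-- Boolean Grassmann coordinate. -/
def gc (m n i j : ℕ) : Bool :=
  (m.testBit i && n.testBit j) ^^ (m.testBit j && n.testBit i)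

lemma gc_eq (m n : ℕ) (i j k l : Fin 7)
    (h : grassCoord (ZMod 2) (dec m) (dec n) i j = grassCoord (ZMod 2) (dec m) (dec n) k l) :
    gc m n i j = gc m n k l := by
  simp only [grassCoord, dec, gb] at h
  simp only [gc]
  revert h
  generalize m.testBit i = a1
  generalize m.testBit j = a2
  generalize m.testBit k = a3
  generalize m.testBit l = a4
  generalize n.testBit i = b1
  generalize n.testBit j = b2
  generalize n.testBit k = b3
  generalize n.testBit l = b4
  revert a1 a2 a3 a4 b1 b2 b3 b4
  decide +kernel

lemma complete : ∀ m ∈ ord, ∀ n ∈ ord, Nat.beq m n = true ∨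
    (m ^^^ n ∈ ord → gc m n 1 2 = gc m n 3 4 → gc m n 5 4 = gc m n 3 2 → gc m n 2 0 = gc m n 3 5 →
      gc m n 6 5 = gc m n 3 0 → gc m n 0 1 = gc m n 3 6 → gc m n 4 6 = gc m n 3 1 →
      (tbl.any fun t => hasPt t m && (hasPt t n && hasPt t (m ^^^ n))) = true) := by
  decide +kernel

lemma hexPoint_code (W : Submodule (ZMod 2) (Fin 7 → ZMod 2)) (hW : IsHexPoint (ZMod 2) W) :
    ∃ t ∈ tbl, ∀ v ∈ pts t, dec v ∈ W := by
  obtain ⟨hr, hQ, hG⟩ := hW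
  let b := Module.finBasisOfFinrankEq (ZMod 2) W hr
  have hli := b.linearIndependent
  obtain ⟨m, hm, hmx⟩ := dec_surj (b 0 : Fin 7 → ZMod 2)
  obtain ⟨n, hn, hnx⟩ := dec_surj (b 1 : Fin 7 → ZMod 2)
  have hmW : dec m ∈ W := hmx ▸ (b 0).2
  have hnW : dec n ∈ W := hnx ▸ (b 1).2
  have hm0 : dec m ≠ 0 := by
    rw [hmx]
    exact fun h => hli.ne_zero 0 (Subtype.ext h)
  have hn0 : dec n ≠ 0 := by
    rw [hnx]
    exact fun h => hli.ne_zero 1 (Subtype.ext h)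
  have hmn : m ≠ n := by
    rintro rfl
    have h01 : b 0 = b 1 := Subtype.ext (hmx.symm.trans hnx)
    exact absurd (hli.injective h01) (by decide)
  obtain ⟨g1, g2, g3, g4, g5, g6⟩ := hG _ hmW _ hnW
  rcases complete m (sing_mem m hm hm0 (hQ _ hmW)) n (sing_mem n hn hn0 (hQ _ hnW)) with h | h
  · exact absurd (Nat.beq_eq ▸ h) hmn
  · have hx0 : dec (m ^^^ n) ≠ 0 := by
      rw [dec_xor, hmx, hnx]
      intro h0
      have h01 : b 0 = b 1 := by
        apply Subtype.ext
        rw [← sub_eq_zero, sub_eq_add_neg, ZModModule.neg_eq_self]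
        exact h0
      exact absurd (hli.injective h01) (by decide)
    have hxo : m ^^^ n ∈ ord := by
      apply sing_mem _ _ hx0
      · exact hQ _ (by rw [dec_xor]; exact W.add_mem hmW hnW)
      · rw [List.mem_range] at hm hn ⊢
        exact Nat.xor_lt_two_pow (n := 7) hm hn
    have h' := h hxo (gc_eq _ _ _ _ _ _ g1) (gc_eq _ _ _ _ _ _ g2) (gc_eq _ _ _ _ _ _ g3)
      (gc_eq _ _ _ _ _ _ g4) (gc_eq _ _ _ _ _ _ g5) (gc_eq _ _ _ _ _ _ g6)
    rw [List.any_eq_true] at h'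
    obtain ⟨t, ht, h'⟩ := h'
    rw [Bool.and_eq_true, Bool.and_eq_true, hasPt_iff, hasPt_iff, hasPt_iff] at h'
    refine ⟨t, ht, ?_⟩
    have hsub : ({m, n, m ^^^ n} : Finset ℕ) = pts t := by
      apply Finset.eq_of_subset_of_card_le
      · intro v hv
        simp only [Finset.mem_insert, Finset.mem_singleton] at hv
        rcases hv with rfl | rfl | rfl
        exacts [h'.1, h'.2.1, h'.2.2]
      · rw [pts_card ht]
        apply le_of_eq
        symm
        rw [Finset.card_eq_three]
        refine ⟨_, _, _, hmn, ?_, ?_, rfl⟩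
        · intro h
          apply hn0
          have := dec_xor m n
          rw [← h] at this
          exact left_eq_add.1 this
        · intro h
          apply hm0
          have := dec_xor m n
          rw [← h] at this
          exact right_eq_add.1 this
    intro v hv
    rw [← hsub] at hv
    simp only [Finset.mem_insert, Finset.mem_singleton] at hv
    rcases hv with rfl | rfl | rfl
    · exact hmW
    · exact hnW
    · rw [dec_xor]
      exact W.add_mem hmW hnW

end H2D

/-- Every partial distance-2 ovoid of the dual split Cayley hexagon `H(2)^D` has at most
`19` elements. -/
theorem partial_ovoid_H2D_le_19
    (O : Set {W : Submodule (ZMod 2) (Fin 7 → ZMod 2) // IsHexPoint (ZMod 2) W})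
    (hO : ∀ l : {U : Submodule (ZMod 2) (Fin 7 → ZMod 2) // IsHexLine (ZMod 2) U},
      ∀ p ∈ O, ∀ p' ∈ O,
        (l : Submodule (ZMod 2) (Fin 7 → ZMod 2)) ≤ (p : Submodule (ZMod 2) (Fin 7 → ZMod 2)) →
        (l : Submodule (ZMod 2) (Fin 7 → ZMod 2)) ≤ (p' : Submodule (ZMod 2) (Fin 7 → ZMod 2)) →
        p = p') :
    O.ncard ≤ 19 := by
  classical
  choose f hft hfW using fun p : {W : Submodule (ZMod 2) (Fin 7 → ZMod 2) //
    IsHexPoint (ZMod 2) W} => H2D.hexPoint_code p.1 p.2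
  have meet : ∀ p ∈ O, ∀ p' ∈ O, ∀ v, v ∈ H2D.pts (f p) → v ∈ H2D.pts (f p') → p = p' := by
    intro p hp p' hp' v hv hv'
    have hv0 : H2D.dec v ≠ 0 :=
      H2D.dec_ne_zero v (List.mem_toFinset.1 (H2D.pts_V (hft p) hv))
    have hle : ∀ W : Submodule (ZMod 2) (Fin 7 → ZMod 2), H2D.dec v ∈ W →
        Submodule.span (ZMod 2) {H2D.dec v} ≤ W := fun W h => by
      rwa [Submodule.span_singleton_le_iff_mem]
    have h1 := hle _ (hfW p v hv)
    have h2 := hle _ (hfW p' v hv')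
    exact hO ⟨Submodule.span (ZMod 2) {H2D.dec v}, finrank_span_singleton hv0,
      fun x hx => p.2.2.1 x (h1 hx)⟩ p hp p' hp' h1 h2
  have hfin : (f '' O).Finite :=
    (List.finite_toSet H2D.tbl).subset (by rintro _ ⟨p, -, rfl⟩; exact hft p)
  have hinj : Set.InjOn f O := by
    intro p hp p' hp' h
    have hv : (f p).1 ∈ H2D.pts (f p) := by simp [H2D.pts]
    exact meet p hp p' hp' _ hv (h ▸ hv)
  rw [← hinj.ncard_image, Set.ncard_eq_toFinset_card _ hfin]
  apply H2D.comb
  · intro t ht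
    obtain ⟨p, -, rfl⟩ := hfin.mem_toFinset.1 ht
    exact hft p
  · intro t ht s hs v hvt hvs
    obtain ⟨p, hp, rfl⟩ := hfin.mem_toFinset.1 ht
    obtain ⟨p', hp', rfl⟩ := hfin.mem_toFinset.1 hs
    rw [meet p hp p' hp' v hvt hvs]
end
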